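/- Every 4×8 matrix Λ over ℤ/2 that is a (ℤ/2)-characteristic matrix over P₁⁴(8) is equivalent over P₁⁴(8) to one of the three matrices b₁, b₂, b₃. -/

import Mathlib

open Matrix

def V1 : List (Fin 4 → Fin 8) :=
  [![0,1,2,3], ![0,1,2,4], ![0,1,3,7], ![0,1,4,5], ![0,1,5,6], ![0,1,6,7], ![0,2,3,4], ![0,3,4,5], ![0,3,5,6], ![0,3,6,7], ![1,2,3,7], ![1,2,4,5], ![1,2,5,7], ![1,5,6,7], ![2,3,4,6], ![2,3,6,7], ![2,4,5,7], ![2,4,6,7], ![3,4,5,6], ![4,5,6,7]]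
def V1F : Finset (Finset (Fin 8)) :=
  {{0,1,2,3}, {0,1,2,4}, {0,1,3,7}, {0,1,4,5}, {0,1,5,6}, {0,1,6,7}, {0,2,3,4}, {0,3,4,5}, {0,3,5,6}, {0,3,6,7}, {1,2,3,7}, {1,2,4,5}, {1,2,5,7}, {1,5,6,7}, {2,3,4,6}, {2,3,6,7}, {2,4,5,7}, {2,4,6,7}, {3,4,5,6}, {4,5,6,7}}
def b1 : Matrix (Fin 4) (Fin 8) (ZMod 2) :=
  !![1, 0, 0, 0, 1, 0, 0, 1;
    0, 1, 0, 0, 1, 1, 1, 0;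
    0, 0, 1, 0, 0, 1, 0, 1;
    0, 0, 0, 1, 1, 1, 1, 1]
def b2 : Matrix (Fin 4) (Fin 8) (ZMod 2) :=
  !![1, 0, 0, 0, 1, 0, 0, 1;
    0, 1, 0, 0, 1, 1, 1, 1;
    0, 0, 1, 0, 0, 1, 0, 1;
    0, 0, 0, 1, 1, 1, 1, 0]
def b3 : Matrix (Fin 4) (Fin 8) (ZMod 2) :=
  !![1, 0, 0, 0, 0, 1, 1, 1;
    0, 1, 0, 0, 1, 0, 1, 0;
    0, 0, 1, 0, 0, 1, 0, 1;
    0, 0, 0, 1, 1, 0, 1, 1]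

/-- The 8×8 permutation matrix of σ over ℤ/2: P_σ e_j = e_(σ j). -/
def permMat (σ : Equiv.Perm (Fin 8)) : Matrix (Fin 8) (Fin 8) (ZMod 2) :=
  Matrix.of fun i j => if i = σ j then 1 else 0

/-- σ is a combinatorial automorphism of the polytope. -/
def IsAut (σ : Equiv.Perm (Fin 8)) : Prop :=
  V1F.image (fun v => v.image (fun x => σ x)) = V1F

/-- Equivalence of characteristic matrices over the polytope. -/
def MatEquiv (Λ Λ' : Matrix (Fin 4) (Fin 8) (ZMod 2)) : Prop :=
  ∃ (g : Matrix (Fin 4) (Fin 4) (ZMod 2)) (σ : Equiv.Perm (Fin 8)),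
    IsUnit g ∧ IsAut σ ∧ Λ' = g * Λ * permMat σ

/-- Explicit 4×4 determinant. -/
def det4 (a b c d e f g h i j k l m n o p : ZMod 2) : ZMod 2 :=
  a * (f * (k * p + l * o) + g * (j * p + l * n) + h * (j * o + k * n))
  + b * (e * (k * p + l * o) + g * (i * p + l * m) + h * (i * o + k * m))
  + c * (e * (j * p + l * n) + f * (i * p + l * m) + h * (i * n + j * m))
  + d * (e * (j * o + k * n) + f * (i * o + k * m) + g * (i * n + j * m))

lemma det_eq_det4 (A : Matrix (Fin 4) (Fin 4) (ZMod 2)) :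
    A.det = det4 (A 0 0) (A 0 1) (A 0 2) (A 0 3) (A 1 0) (A 1 1) (A 1 2) (A 1 3)
      (A 2 0) (A 2 1) (A 2 2) (A 2 3) (A 3 0) (A 3 1) (A 3 2) (A 3 3) := by
  simp [Matrix.det_succ_row_zero, Fin.sum_univ_succ, Fin.succAbove, det4]
  ring

/-- Search predicate, StageEnd. -/
def StageEnd (a0 a1 a2 a3 b0 b1 b2 b3 d0 d1 d2 d3 c0 c1 c2 c3 : ZMod 2) : Prop :=
    (a0 = 1 ∧ a1 = 1 ∧ a2 = 0 ∧ a3 = 1 ∧ b0 = 0 ∧ b1 = 1 ∧ b2 = 1 ∧ b3 = 1 ∧ c0 = 0 ∧ c1 = 1 ∧ c2 = 0 ∧ c3 = 1 ∧ d0 = 1 ∧ d1 = 0 ∧ d2 = 1 ∧ d3 = 1) ∨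
    (a0 = 1 ∧ a1 = 1 ∧ a2 = 0 ∧ a3 = 1 ∧ b0 = 0 ∧ b1 = 1 ∧ b2 = 1 ∧ b3 = 1 ∧ c0 = 0 ∧ c1 = 1 ∧ c2 = 0 ∧ c3 = 1 ∧ d0 = 1 ∧ d1 = 1 ∧ d2 = 1 ∧ d3 = 0) ∨
    (a0 = 0 ∧ a1 = 1 ∧ a2 = 0 ∧ a3 = 1 ∧ b0 = 1 ∧ b1 = 0 ∧ b2 = 1 ∧ b3 = 0 ∧ c0 = 1 ∧ c1 = 1 ∧ c2 = 0 ∧ c3 = 1 ∧ d0 = 1 ∧ d1 = 0 ∧ d2 = 1 ∧ d3 = 1)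

instance (a0 a1 a2 a3 b0 b1 b2 b3 d0 d1 d2 d3 c0 c1 c2 c3) : Decidable (StageEnd a0 a1 a2 a3 b0 b1 b2 b3 d0 d1 d2 d3 c0 c1 c2 c3) := by
  unfold StageEnd
  infer_instance

/-- Search predicate, StageC3. -/
def StageC3 (a0 a1 a2 a3 b0 b1 b2 b3 d0 d1 d2 d3 c0 c1 c2 c3 : ZMod 2) : Prop :=
    det4 0 0 a0 c0 0 0 a1 c1 1 0 a2 c2 0 1 a3 c3 ≠ 0 →
    det4 0 0 c0 d0 0 0 c1 d1 1 0 c2 d2 0 1 c3 d3 ≠ 0 →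
    det4 0 a0 c0 d0 0 a1 c1 d1 1 a2 c2 d2 0 a3 c3 d3 ≠ 0 →
    det4 0 a0 b0 c0 0 a1 b1 c1 0 a2 b2 c2 1 a3 b3 c3 ≠ 0 →
    det4 a0 b0 c0 d0 a1 b1 c1 d1 a2 b2 c2 d2 a3 b3 c3 d3 ≠ 0 →
    StageEnd a0 a1 a2 a3 b0 b1 b2 b3 d0 d1 d2 d3 c0 c1 c2 c3

instance (a0 a1 a2 a3 b0 b1 b2 b3 d0 d1 d2 d3 c0 c1 c2 c3) : Decidable (StageC3 a0 a1 a2 a3 b0 b1 b2 b3 d0 d1 d2 d3 c0 c1 c2 c3) := by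
  unfold StageC3
  infer_instance

/-- Search predicate, StageC2. -/
def StageC2 (a0 a1 a2 a3 b0 b1 b2 b3 d0 d1 d2 d3 c0 c1 c2 c3 : ZMod 2) : Prop :=
    det4 1 0 b0 c0 0 1 b1 c1 0 0 b2 c2 0 0 b3 c3 ≠ 0 →
    det4 1 0 c0 d0 0 1 c1 d1 0 0 c2 d2 0 0 c3 d3 ≠ 0 →
    det4 1 0 b0 c0 0 0 b1 c1 0 0 b2 c2 0 1 b3 c3 ≠ 0 →
    det4 1 0 c0 d0 0 0 c1 d1 0 0 c2 d2 0 1 c3 d3 ≠ 0 →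
    det4 0 b0 c0 d0 1 b1 c1 d1 0 b2 c2 d2 0 b3 c3 d3 ≠ 0 →
    StageC3 a0 a1 a2 a3 b0 b1 b2 b3 d0 d1 d2 d3 c0 c1 c2 c3

instance (a0 a1 a2 a3 b0 b1 b2 b3 d0 d1 d2 d3 c0 c1 c2 c3) : Decidable (StageC2 a0 a1 a2 a3 b0 b1 b2 b3 d0 d1 d2 d3 c0 c1 c2 c3) := by
  unfold StageC2
  infer_instance

/-- Search predicate, StageC. -/
def StageC (a0 a1 a2 a3 b0 b1 b2 b3 d0 d1 d2 d3 : ZMod 2) : Prop :=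
    ∀ c0 c1 c2 c3 : ZMod 2,
    StageC2 a0 a1 a2 a3 b0 b1 b2 b3 d0 d1 d2 d3 c0 c1 c2 c3

instance (a0 a1 a2 a3 b0 b1 b2 b3 d0 d1 d2 d3) : Decidable (StageC a0 a1 a2 a3 b0 b1 b2 b3 d0 d1 d2 d3) := by
  unfold StageC
  infer_instance

/-- Search predicate, StageD. -/
def StageD (a0 a1 a2 a3 b0 b1 b2 b3 : ZMod 2) : Prop :=
    ∀ d0 d1 d2 d3 : ZMod 2,
    det4 1 0 0 d0 0 1 0 d1 0 0 0 d2 0 0 1 d3 ≠ 0 →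
    det4 0 0 0 d0 1 0 0 d1 0 1 0 d2 0 0 1 d3 ≠ 0 →
    det4 0 0 b0 d0 1 0 b1 d1 0 1 b2 d2 0 0 b3 d3 ≠ 0 →
    det4 0 a0 b0 d0 0 a1 b1 d1 1 a2 b2 d2 0 a3 b3 d3 ≠ 0 →
    StageC a0 a1 a2 a3 b0 b1 b2 b3 d0 d1 d2 d3

instance (a0 a1 a2 a3 b0 b1 b2 b3) : Decidable (StageD a0 a1 a2 a3 b0 b1 b2 b3) := by
  unfold StageD
  infer_instance

set_option maxRecDepth 100000 in
/-- The finite search. -/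
lemma search : ∀ a0 a1 a2 a3 : ZMod 2,
    det4 1 0 0 a0 0 1 0 a1 0 0 1 a2 0 0 0 a3 ≠ 0 →
    det4 1 0 0 a0 0 0 0 a1 0 1 0 a2 0 0 1 a3 ≠ 0 →
    ∀ b0 b1 b2 b3 : ZMod 2,
    det4 1 0 a0 b0 0 1 a1 b1 0 0 a2 b2 0 0 a3 b3 ≠ 0 →
    det4 1 0 a0 b0 0 0 a1 b1 0 0 a2 b2 0 1 a3 b3 ≠ 0 →
    det4 0 0 a0 b0 1 0 a1 b1 0 1 a2 b2 0 0 a3 b3 ≠ 0 →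
    StageD a0 a1 a2 a3 b0 b1 b2 b3 := by
  decide +kernel

lemma permMat_one : permMat 1 = 1 := by
  ext i j
  by_cases h : i = j
  · subst h
    simp [permMat]
  · simp [permMat, h]

lemma isAut_one : IsAut 1 := by
  simp [IsAut]

/-- Every (ℤ/2)-characteristic matrix over P₁⁴(8) is equivalent to b₁, b₂ or b₃. -/
theorem stmt7 (Λ : Matrix (Fin 4) (Fin 8) (ZMod 2))
    (hchar : ∀ v ∈ V1, IsUnit (Λ.submatrix id v).det) :
    MatEquiv Λ b1 ∨ MatEquiv Λ b2 ∨ MatEquiv Λ b3 := by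
  have h0 := hchar ![0,1,2,3] (by simp [V1])
  set M := Λ.submatrix id ![0,1,2,3] with hM
  have hinv : M⁻¹ * M = 1 := Matrix.nonsing_inv_mul M h0
  have hg : IsUnit M⁻¹ := by
    rw [Matrix.isUnit_nonsing_inv_iff]
    exact (Matrix.isUnit_iff_isUnit_det M).2 h0
  obtain ⟨N, hN⟩ : ∃ N, N = M⁻¹ * Λ := ⟨_, rfl⟩
  have hsub : ∀ v : Fin 4 → Fin 8, N.submatrix id v = M⁻¹ * Λ.submatrix id v := by
    intro v
    rw [hN]
    rfl
  have hstd : ∀ i j, N i (![0,1,2,3] j) = (1 : Matrix (Fin 4) (Fin 4) (ZMod 2)) i j := by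
    intro i j
    rw [← hinv, hM, ← hsub]
    rfl
  have e : ∀ i : Fin 4, N i 0 = (1 : Matrix (Fin 4) (Fin 4) (ZMod 2)) i 0 ∧ N i 1 = (1 : Matrix (Fin 4) (Fin 4) (ZMod 2)) i 1
      ∧ N i 2 = (1 : Matrix (Fin 4) (Fin 4) (ZMod 2)) i 2 ∧ N i 3 = (1 : Matrix (Fin 4) (Fin 4) (ZMod 2)) i 3 :=
    fun i => ⟨hstd i 0, hstd i 1, hstd i 2, hstd i 3⟩
  obtain ⟨e00, e01, e02, e03⟩ := e 0
  obtain ⟨e10, e11, e12, e13⟩ := e 1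
  obtain ⟨e20, e21, e22, e23⟩ := e 2
  obtain ⟨e30, e31, e32, e33⟩ := e 3
  simp at e00 e01 e02 e03 e10 e11 e12 e13 e20 e21 e22 e23 e30 e31 e32 e33
  have key : ∀ v ∈ V1, det4 (N 0 (v 0)) (N 0 (v 1)) (N 0 (v 2)) (N 0 (v 3))
      (N 1 (v 0)) (N 1 (v 1)) (N 1 (v 2)) (N 1 (v 3))
      (N 2 (v 0)) (N 2 (v 1)) (N 2 (v 2)) (N 2 (v 3))
      (N 3 (v 0)) (N 3 (v 1)) (N 3 (v 2)) (N 3 (v 3)) ≠ 0 := by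
    intro v hv
    have h : IsUnit (N.submatrix id v).det := by
      rw [hsub, Matrix.det_mul]
      exact ((Matrix.isUnit_iff_isUnit_det _).1 hg).mul (hchar v hv)
    have h2 := h.ne_zero
    rw [det_eq_det4] at h2
    exact h2
  have fin : ∀ b, N = b → MatEquiv Λ b := by
    intro b hb
    refine ⟨M⁻¹, 1, hg, isAut_one, ?_⟩
    rw [permMat_one, Matrix.mul_one, ← hN, hb]
  have k0124 := key ![0,1,2,4] (by simp [V1])
  have k0234 := key ![0,2,3,4] (by simp [V1])
  have k0145 := key ![0,1,4,5] (by simp [V1])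
  have k0345 := key ![0,3,4,5] (by simp [V1])
  have k1245 := key ![1,2,4,5] (by simp [V1])
  have k0137 := key ![0,1,3,7] (by simp [V1])
  have k1237 := key ![1,2,3,7] (by simp [V1])
  have k1257 := key ![1,2,5,7] (by simp [V1])
  have k2457 := key ![2,4,5,7] (by simp [V1])
  have k0156 := key ![0,1,5,6] (by simp [V1])
  have k0167 := key ![0,1,6,7] (by simp [V1])
  have k0356 := key ![0,3,5,6] (by simp [V1])
  have k0367 := key ![0,3,6,7] (by simp [V1])
  have k1567 := key ![1,5,6,7] (by simp [V1])
  have k2346 := key ![2,3,4,6] (by simp [V1])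
  have k2367 := key ![2,3,6,7] (by simp [V1])
  have k2467 := key ![2,4,6,7] (by simp [V1])
  have k3456 := key ![3,4,5,6] (by simp [V1])
  have k4567 := key ![4,5,6,7] (by simp [V1])
  simp only [Matrix.cons_val, e00, e01, e02, e03, e10, e11, e12, e13, e20, e21, e22, e23, e30, e31, e32, e33] at k0124 k0234 k0145 k0345 k1245 k0137 k1237 k1257 k2457 k0156 k0167 k0356 k0367 k1567 k2346 k2367 k2467 k3456 k4567
  have res := search (N 0 4) (N 1 4) (N 2 4) (N 3 4) k0124 k0234
    (N 0 5) (N 1 5) (N 2 5) (N 3 5) k0145 k0345 k1245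
    (N 0 7) (N 1 7) (N 2 7) (N 3 7) k0137 k1237 k1257 k2457
    (N 0 6) (N 1 6) (N 2 6) (N 3 6) k0156 k0167 k0356 k0367 k1567 k2346 k2367 k2467 k3456 k4567
  have ext8 : ∀ b : Matrix (Fin 4) (Fin 8) (ZMod 2), (∀ i, N i 0 = b i 0 ∧ N i 1 = b i 1 ∧ N i 2 = b i 2 ∧
      N i 3 = b i 3 ∧ N i 4 = b i 4 ∧ N i 5 = b i 5 ∧ N i 6 = b i 6 ∧ N i 7 = b i 7) → N = b := by
    intro b h
    ext i j
    obtain ⟨h0, h1, h2, h3, h4, h5, h6, h7⟩ := h i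
    fin_cases j <;> assumption
  clear key hstd e hsub hN
  rcases res with h | h | h
  · left
    apply fin
    apply ext8
    intro i
    fin_cases i <;> simp [b1, *]
  · right; left
    apply fin
    apply ext8
    intro i
    fin_cases i <;> simp [b2, *]
  · right; right
    apply fin
    apply ext8
    intro i
    fin_cases i <;> simp [b3, *]
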